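/- No two chordal roots of Λ are orthogonal: if r and s are chordal roots of Λ, then ⟨r,s⟩ ≠ 0. -/

import Mathlib

noncomputable section

/-- The primitive cube root of unity `ω = e^{2πi/3}`. -/
def ω : ℂ := ⟨-1/2, Real.sqrt 3 / 2⟩

/-- `θ = ω - ω̄`, a square root of `-3`. -/
def θ : ℂ := ω - (starRingEnd ℂ) ω

/-- The ring of Eisenstein integers `ℰ = ℤ[ω]` as a subring of ℂ. -/
def Eis : Subring ℂ := Subring.closure {ω}

/-- The Gram matrix of `E₈^ℰ`. -/
def Bmat : Matrix (Fin 4) (Fin 4) ℂ :=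
  !![3, θ, 0, 0; -θ, 3, θ, 0; 0, -θ, 3, θ; 0, 0, -θ, 3]

/-- The Gram matrix of the hyperbolic cell `H`. -/
def Cmat : Matrix (Fin 2) (Fin 2) ℂ := !![0, θ; -θ, 0]

/-- The Gram matrix of `Λ₁₀`: block diagonal with blocks B, B, C. -/
def Lam10 : Matrix (Fin 10) (Fin 10) ℂ := Matrix.of fun i j =>
  if h : i.val < 4 ∧ j.val < 4 then Bmat ⟨i.val, h.1⟩ ⟨j.val, h.2⟩
  else if h : 4 ≤ i.val ∧ i.val < 8 ∧ 4 ≤ j.val ∧ j.val < 8 then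
    Bmat ⟨i.val - 4, by omega⟩ ⟨j.val - 4, by omega⟩
  else if h : 8 ≤ i.val ∧ 8 ≤ j.val then
    Cmat ⟨i.val - 8, by have := i.isLt; omega⟩ ⟨j.val - 8, by have := j.isLt; omega⟩
  else 0

/-- The Gram matrix of `Λ = (3) ⊕ Λ₁₀`: block diagonal with blocks (3), B, B, C. -/
def Lam11 : Matrix (Fin 11) (Fin 11) ℂ := Matrix.of fun i j =>
  if i.val = 0 ∧ j.val = 0 then 3
  else if h : 1 ≤ i.val ∧ 1 ≤ j.val then
    Lam10 ⟨i.val - 1, by have := i.isLt; omega⟩ ⟨j.val - 1, by have := j.isLt; omega⟩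
  else 0

/-- The Hermitian form of `Λ`, on vectors with complex entries. -/
def herm11C (x y : Fin 11 → ℂ) : ℂ :=
  ∑ i : Fin 11, ∑ j : Fin 11, Lam11 i j * x i * (starRingEnd ℂ) (y j)

/-- The ideal `θℰ ⊆ ℂ`. -/
def thetaEis : Set ℂ := {z | ∃ e : Eis, z = θ * (e : ℂ)}

/-- The ideal `3ℰ ⊆ ℂ`. -/
def threeEis : Set ℂ := {z | ∃ e : Eis, z = 3 * (e : ℂ)}

/-- The set `{⟨r,x⟩ : x ∈ Λ}` of inner products of `r` with lattice vectors. -/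
def innerSet (r : Fin 11 → ℂ) : Set ℂ :=
  {c | ∃ x : Fin 11 → ℂ, (∀ i, x i ∈ Eis) ∧ c = herm11C r x}

open ComplexConjugate

theorem omega_mem_Eis : ω ∈ Eis := Subring.subset_closure rfl

theorem conj_omega : conj ω = -1 - ω := by
  apply Complex.ext <;> norm_num [ω]

theorem conj_mem_Eis {z : ℂ} (hz : z ∈ Eis) : conj z ∈ Eis := by
  have hle : Eis ≤ Eis.comap (starRingEnd ℂ) := by
    refine Subring.closure_le.2 (Set.singleton_subset_iff.2 ?_)
    change conj ω ∈ Eis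
    rw [conj_omega]
    exact sub_mem (neg_mem (one_mem _)) omega_mem_Eis
  exact hle hz

theorem theta_mem_Eis : θ ∈ Eis := sub_mem omega_mem_Eis (conj_mem_Eis omega_mem_Eis)

theorem omega_sq : ω ^ 2 = -1 - ω := by
  have h : Real.sqrt 3 * Real.sqrt 3 = 3 := Real.mul_self_sqrt (by norm_num)
  apply Complex.ext
  · simp [ω, sq]
    linarith
  · simp [ω, sq]
    ring

theorem theta_mul_self : θ * θ = -3 := by
  rw [θ, conj_omega]
  linear_combination 4 * omega_sq

theorem theta_ne_zero : θ ≠ 0 := by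
  intro h
  have := theta_mul_self
  norm_num [h] at this

theorem conj_theta : conj θ = -θ := by simp [θ]

/-- The norm of an Eisenstein integer is a rational integer. -/
theorem exists_int_mul_conj_eq {z : ℂ} (hz : z ∈ Eis) : ∃ n : ℤ, z * conj z = n := by
  have hab : ∃ a b : ℤ, z = a + b * ω := by
    induction hz using Subring.closure_induction with
    | mem x hx => exact ⟨0, 1, by simpa using hx⟩
    | zero => exact ⟨0, 0, by simp⟩
    | one => exact ⟨1, 0, by simp⟩
    | add x y _ _ hx hy =>
      obtain ⟨a, b, rfl⟩ := hx
      obtain ⟨c, d, rfl⟩ := hy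
      exact ⟨a + c, b + d, by push_cast; ring⟩
    | neg x _ hx =>
      obtain ⟨a, b, rfl⟩ := hx
      exact ⟨-a, -b, by push_cast; ring⟩
    | mul x y _ _ hx hy =>
      obtain ⟨a, b, rfl⟩ := hx
      obtain ⟨c, d, rfl⟩ := hy
      refine ⟨a * c - b * d, a * d + b * c - b * d, ?_⟩
      push_cast
      linear_combination (b * d : ℂ) * omega_sq
  obtain ⟨a, b, rfl⟩ := hab
  refine ⟨a ^ 2 - a * b + b ^ 2, ?_⟩
  simp only [map_add, map_mul, map_intCast, conj_omega]
  push_cast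
  linear_combination (-b ^ 2 : ℂ) * omega_sq

theorem theta_mul_ne_one {e : ℂ} (he : e ∈ Eis) : θ * e ≠ 1 := by
  intro h
  obtain ⟨n, hn⟩ := exists_int_mul_conj_eq he
  have hc := congrArg (starRingEnd ℂ) h
  rw [map_mul, conj_theta, map_one] at hc
  have h3 : (3 * n : ℂ) = 1 := by
    linear_combination -3 * hn + θ * e * hc + h + e * conj e * theta_mul_self
  have : 3 * n = 1 := by exact_mod_cast h3
  omega

theorem herm11C_eq_sum (r s : Fin 11 → ℂ) :
    herm11C r s = ∑ j, (∑ i, Lam11 i j * r i) * conj (s j) := by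
  rw [herm11C, Finset.sum_comm]
  simp only [Finset.sum_mul]

/-- The inner products of a chordal root with the standard basis vectors lie in `3ℰ`. -/
theorem exists_sum_Lam11_eq {r : Fin 11 → ℂ} (h : innerSet r = threeEis) (j : Fin 11) :
    ∃ c ∈ Eis, ∑ i, Lam11 i j * r i = 3 * c := by
  have hm : herm11C r (Pi.single j 1) ∈ threeEis := by
    rw [← h]
    refine ⟨_, fun i => ?_, rfl⟩
    rcases eq_or_ne i j with rfl | hij
    · simp [one_mem]
    · simp [hij, zero_mem]
  obtain ⟨e, he⟩ := hm
  refine ⟨e, e.2, ?_⟩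
  simpa [herm11C_eq_sum, Pi.single_apply, apply_ite] using he

/-- If the inner products of `x` with the standard basis of `E₈^ℰ` lie in `3ℰ`, then `x` is divisible
by `θ`. -/
theorem exists_eq_theta_mul_of_block {x₁ x₂ x₃ x₄ c₁ c₂ c₃ c₄ : ℂ}
    (hx₁ : x₁ ∈ Eis) (hx₂ : x₂ ∈ Eis) (hx₃ : x₃ ∈ Eis) (hx₄ : x₄ ∈ Eis)
    (hc₁ : c₁ ∈ Eis) (hc₂ : c₂ ∈ Eis) (hc₃ : c₃ ∈ Eis) (hc₄ : c₄ ∈ Eis)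
    (h₁ : 3 * x₁ + -(θ * x₂) = 3 * c₁) (h₂ : θ * x₁ + (3 * x₂ + -(θ * x₃)) = 3 * c₂)
    (h₃ : θ * x₂ + (3 * x₃ + -(θ * x₄)) = 3 * c₃) (h₄ : θ * x₃ + 3 * x₄ = 3 * c₄) :
    (∃ w ∈ Eis, x₁ = θ * w) ∧ (∃ w ∈ Eis, x₂ = θ * w) ∧
      (∃ w ∈ Eis, x₃ = θ * w) ∧ ∃ w ∈ Eis, x₄ = θ * w := by
  have e₂ : x₂ = θ * (c₁ - x₁) := mul_left_cancel₀ theta_ne_zero <| by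
    linear_combination -h₁ - (c₁ - x₁) * theta_mul_self
  have e₃ : x₃ = θ * (x₄ - c₄) := mul_left_cancel₀ theta_ne_zero <| by
    linear_combination h₄ - (x₄ - c₄) * theta_mul_self
  have e₁ : x₁ = θ * (x₄ - c₄ + x₂ - c₂) := mul_left_cancel₀ theta_ne_zero <| by
    linear_combination h₂ - (x₂ - c₂) * theta_mul_self + θ * e₃
  have e₄ : x₄ = θ * (c₁ - x₁ - x₃ + c₃) := mul_left_cancel₀ theta_ne_zero <| by
    linear_combination -h₃ - (c₃ - x₃) * theta_mul_self + θ * e₂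
  exact ⟨⟨_, sub_mem (add_mem (sub_mem hx₄ hc₄) hx₂) hc₂, e₁⟩, ⟨_, sub_mem hc₁ hx₁, e₂⟩,
    ⟨_, sub_mem hx₄ hc₄, e₃⟩, ⟨_, add_mem (sub_mem (sub_mem hc₁ hx₁) hx₃) hc₃, e₄⟩⟩

/-- All coordinates of a chordal root but the first are divisible by `θ`. -/
theorem exists_succ_eq_theta_mul {r : Fin 11 → ℂ} (hr : ∀ i, r i ∈ Eis)
    (h : innerSet r = threeEis) (i : Fin 10) : ∃ w ∈ Eis, r i.succ = θ * w := by
  choose c hc hs using exists_sum_Lam11_eq h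
  have h1 := hs 1
  have h2 := hs 2
  have h3 := hs 3
  have h4 := hs 4
  have h5 := hs 5
  have h6 := hs 6
  have h7 := hs 7
  have h8 := hs 8
  have h9 := hs 9
  have h10 := hs 10
  simp [Lam11, Lam10, Bmat, Cmat, Fin.sum_univ_succ] at h1 h2 h3 h4 h5 h6 h7 h8 h9 h10
  obtain ⟨w1, w2, w3, w4⟩ := exists_eq_theta_mul_of_block (hr 1) (hr 2) (hr 3) (hr 4)
    (hc 1) (hc 2) (hc 3) (hc 4) h1 h2 h3 h4
  obtain ⟨w5, w6, w7, w8⟩ := exists_eq_theta_mul_of_block (hr 5) (hr 6) (hr 7) (hr 8)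
    (hc 5) (hc 6) (hc 7) (hc 8) h5 h6 h7 h8
  have w9 : ∃ w ∈ Eis, r 9 = θ * w :=
    ⟨-c 10, neg_mem (hc 10), mul_left_cancel₀ theta_ne_zero <| by
      linear_combination h10 + c 10 * theta_mul_self⟩
  have w10 : ∃ w ∈ Eis, r 10 = θ * w :=
    ⟨c 9, hc 9, mul_left_cancel₀ theta_ne_zero <| by
      linear_combination -h9 - c 9 * theta_mul_self⟩
  fin_cases i <;> assumption

/-- Inner products of chordal roots, modulo `3θℰ`. -/
theorem exists_herm11C_eq {r s : Fin 11 → ℂ} (hs : ∀ i, s i ∈ Eis)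
    (h : innerSet r = threeEis) (h' : innerSet s = threeEis) :
    ∃ g ∈ Eis, herm11C r s = 3 * (r 0 * conj (s 0) + θ * g) := by
  choose c hc hrc using exists_sum_Lam11_eq h
  choose w hw hsw using exists_succ_eq_theta_mul hs h'
  refine ⟨-∑ j : Fin 10, c j.succ * conj (w j),
    neg_mem (sum_mem fun j _ => mul_mem (hc _) (conj_mem_Eis (hw j))), ?_⟩
  have h0 : ∑ i, Lam11 i 0 * r i = 3 * r 0 := by
    simp [Lam11]
  rw [herm11C_eq_sum, Fin.sum_univ_succ, h0]
  simp only [hrc, hsw, map_mul, conj_theta]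
  rw [mul_neg, mul_add, mul_neg, Finset.mul_sum, Finset.mul_sum, ← Finset.sum_neg_distrib]
  congr 1
  · ring
  · exact Finset.sum_congr rfl fun j _ => by ring

/-- No two chordal roots of `Λ` are orthogonal: if `r` and `s` are
chordal roots, then `⟨r,s⟩ ≠ 0`. -/
theorem stmt_15 :
    ∀ r s : Fin 11 → ℂ,
      (∀ i, r i ∈ Eis) → (∀ i, s i ∈ Eis) →
      herm11C r r = 3 → herm11C s s = 3 →
      innerSet r = threeEis → innerSet s = threeEis →
      herm11C r s ≠ 0 := by
  intro r s hr hs hrr hss hri hsi h0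
  obtain ⟨e, he, hre⟩ := exists_herm11C_eq hr hri hri
  obtain ⟨f, hf, hsf⟩ := exists_herm11C_eq hs hsi hsi
  obtain ⟨g, hg, hrsg⟩ := exists_herm11C_eq hs hri hsi
  have ha : r 0 * conj (r 0) = 1 - θ * e := by linear_combination (hrr - hre) / 3
  have hb : s 0 * conj (s 0) = 1 - θ * f := by linear_combination (hss - hsf) / 3
  have hab : r 0 * conj (s 0) = -(θ * g) := by linear_combination (h0 - hrsg) / 3
  refine theta_mul_ne_one (e := e + f - θ * e * f - g * conj (r 0) * s 0) ?_ ?_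
  · exact sub_mem (sub_mem (add_mem he hf) (mul_mem (mul_mem theta_mem_Eis he) hf))
      (mul_mem (mul_mem hg (conj_mem_Eis (hr 0))) (hs 0))
  · linear_combination s 0 * conj (s 0) * ha + (1 - θ * e) * hb - conj (r 0) * s 0 * hab
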